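/- In any Crew instance in which all cards have the same suit (s = 1) and the card of every objective lies in the hand of the player assigned that objective, if a successful play sequence exists, then a successful play sequence consisting of exactly |O| tricks exists, each trick of which completes exactly one objective. -/

import Mathlib

/-- A card is a pair (value, suit). -/
abbrev Card : Type := ℕ × ℕ

/-- A trick from state `st` led by `lead` with plays `play` is legal:
every hand is nonempty, each player plays a card from their own hand,
and every player follows the led suit if able. -/
def TrickOk {p : ℕ} (st : Fin p → Finset Card) (lead : Fin p) (play : Fin p → Card) : Prop :=
  (∀ i, (st i).Nonempty) ∧ (∀ i, play i ∈ st i) ∧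
  (∀ i, (play i).2 = (play lead).2 ∨ ∀ c ∈ st i, c.2 ≠ (play lead).2)

/-- Player `w` wins the trick: `w`'s card is of the led suit and strictly
beats every other card of the led suit. -/
def Wins {p : ℕ} (lead : Fin p) (play : Fin p → Card) (w : Fin p) : Prop :=
  (play w).2 = (play lead).2 ∧
  ∀ j, j ≠ w → (play j).2 = (play lead).2 → (play j).1 < (play w).1

/-- A played trick: its leader, the card played by each player, and its winner. -/
structure Trick (p : ℕ) where
  lead : Fin p
  play : Fin p → Card
  winner : Fin p

/-- After a trick, each played card is removed from its owner's hand. -/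
def nextState {p : ℕ} (st : Fin p → Finset Card) (play : Fin p → Card) :
    Fin p → Finset Card :=
  fun i => (st i).erase (play i)

/-- `PlaysFrom st lead L fin`: starting from hands `st` with `lead` to lead the
first trick, the list of tricks `L` is a legal play sequence ending in hands `fin`;
the winner of each trick leads the next. -/
inductive PlaysFrom {p : ℕ} :
    (Fin p → Finset Card) → Fin p → List (Trick p) → (Fin p → Finset Card) → Prop
  | nil (st : Fin p → Finset Card) (lead : Fin p) : PlaysFrom st lead [] st
  | cons {st : Fin p → Finset Card} {lead : Fin p} {play : Fin p → Card} {w : Fin p}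
      {rest : List (Trick p)} {fin : Fin p → Finset Card} :
      TrickOk st lead play → Wins lead play w →
      PlaysFrom (nextState st play) w rest fin →
      PlaysFrom st lead (⟨lead, play, w⟩ :: rest) fin

/-- Objective `o = (c, i)` is completed in trick `t` if card `c` is played in `t`
and player `i` wins `t`. -/
def Completes {p : ℕ} (t : Trick p) (o : Card × Fin p) : Prop :=
  (∃ j, t.play j = o.1) ∧ t.winner = o.2

instance {p : ℕ} (t : Trick p) (o : Card × Fin p) : Decidable (Completes t o) :=
  inferInstanceAs (Decidable ((∃ j, t.play j = o.1) ∧ t.winner = o.2))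

/-- A play sequence is successful if every objective is completed in some trick. -/
def Successful {p : ℕ} (O : Finset (Card × Fin p)) (L : List (Trick p)) : Prop :=
  ∀ o ∈ O, ∃ t ∈ L, Completes t o

/-- The structural conditions on a Crew instance: hands are pairwise disjoint
(cards are distinct), every objective card is in some hand, and no two
objectives share a card. -/
def ValidInstance {p : ℕ} (hand : Fin p → Finset Card) (O : Finset (Card × Fin p)) : Prop :=
  (∀ i j : Fin p, i ≠ j → Disjoint (hand i) (hand j)) ∧
  (∀ o ∈ O, ∃ i, o.1 ∈ hand i) ∧
  (∀ o ∈ O, ∀ q ∈ O, o.1 = q.1 → o = q)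

/-- The instance admits a successful play sequence (with an arbitrary first leader). -/
def HasSuccess {p : ℕ} (hand : Fin p → Finset Card) (O : Finset (Card × Fin p)) : Prop :=
  ∃ lead L fin, PlaysFrom hand lead L fin ∧ Successful O L

/-- Every card played in a play sequence comes from its player's initial hand. -/
theorem PlaysFrom.play_mem {p : ℕ} {st fin : Fin p → Finset Card} {lead : Fin p}
    {L : List (Trick p)} (h : PlaysFrom st lead L fin) :
    ∀ t ∈ L, ∀ i, t.play i ∈ st i := by
  induction h with
  | nil => simp
  | cons hok _ _ ih =>
    intro t ht i
    rcases List.mem_cons.1 ht with rfl | ht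
    · exact hok.2.1 i
    · exact Finset.mem_of_mem_erase (ih t ht i)

/-- No player wins two tricks of a play sequence with the same card. -/
theorem PlaysFrom.nodup_winning_plays {p : ℕ} {st fin : Fin p → Finset Card} {lead : Fin p}
    {L : List (Trick p)} (h : PlaysFrom st lead L fin) :
    (L.map fun t => (t.play t.winner, t.winner)).Nodup := by
  induction h with
  | nil => simp
  | cons _ _ hrest ih =>
    refine List.nodup_cons.2 ⟨fun hmem => ?_, ih⟩
    obtain ⟨t, ht, heq⟩ := List.mem_map.1 hmem
    obtain ⟨h1, h2⟩ := Prod.mk.inj heq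
    have hplay := hrest.play_mem t ht t.winner
    rw [h1, h2] at hplay
    exact Finset.notMem_erase _ _ hplay

/-- In a single suit, any selection of the tricks of a play sequence can be played on its own,
from possibly larger hands and with any first leader. -/
theorem PlaysFrom.exists_filter {p : ℕ} (P : (Fin p → Card) × Fin p → Prop) [DecidablePred P]
    {st fin : Fin p → Finset Card} {lead : Fin p} {L : List (Trick p)}
    (h : PlaysFrom st lead L fin) {y : ℕ} (st' : Fin p → Finset Card) (lead' : Fin p)
    (hsub : ∀ i, st i ⊆ st' i) (hsuit : ∀ i, ∀ c ∈ st' i, c.2 = y) :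
    ∃ L' fin', PlaysFrom st' lead' L' fin' ∧
      L'.map (fun t => (t.play, t.winner)) =
        (L.map fun t => (t.play, t.winner)).filter P := by
  induction h generalizing st' lead' with
  | nil => exact ⟨[], st', .nil _ _, rfl⟩
  | @cons st lead play w rest fin hok hwin _ ih =>
    have hplay : ∀ i, (play i).2 = y := fun i => hsuit i _ (hsub i (hok.2.1 i))
    by_cases hP : P (play, w)
    · obtain ⟨L', fin', hL', hmap⟩ := ih (nextState st' play) w
        (fun i => Finset.erase_subset_erase _ (hsub i))
        (fun i c hc => hsuit i c (Finset.mem_of_mem_erase hc))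
      refine ⟨⟨lead', play, w⟩ :: L', fin', .cons ⟨fun i => (hok.1 i).mono (hsub i),
        fun i => hsub i (hok.2.1 i), fun i => .inl ?_⟩ ⟨?_, fun j hj _ => hwin.2 j hj ?_⟩ hL', ?_⟩
      · rw [hplay, hplay]
      · rw [hplay, hplay]
      · rw [hplay, hplay]
      · simp [hP, hmap]
    · obtain ⟨L', fin', hL', hmap⟩ := ih st' lead'
        (fun i => (Finset.erase_subset _ _).trans (hsub i)) hsuit
      exact ⟨L', fin', hL', by simp [hP, hmap]⟩

/-- When objective cards are owned by their assigned players, a trick completes exactly the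
objective formed by its winning card and its winner. -/
theorem Completes.eq_winning_play {p : ℕ} {hand : Fin p → Finset Card}
    (hdisj : ∀ i j : Fin p, i ≠ j → Disjoint (hand i) (hand j)) {t : Trick p}
    (ht : ∀ i, t.play i ∈ hand i) {o : Card × Fin p} (ho : o.1 ∈ hand o.2)
    (h : Completes t o) : o = (t.play t.winner, t.winner) := by
  obtain ⟨⟨j, hj⟩, hw⟩ := h
  have hjo : j = o.2 := by
    by_contra hne
    exact Finset.disjoint_left.1 (hdisj j o.2 hne) (hj ▸ ht j) ho
  subst hjo
  rw [hw, hj]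

/-- In any single-suit Crew instance whose objective cards are owned
by the players assigned to them, if a successful play sequence exists, then one
exists with exactly |O| tricks, each completing exactly one objective. -/
theorem crew_owned_single_suit_short_success {p : ℕ} (hp : 2 ≤ p)
    (hand : Fin p → Finset Card) (O : Finset (Card × Fin p))
    (hvalid : ValidInstance hand O)
    (hsuit : ∀ i : Fin p, ∀ c ∈ hand i, c.2 = 1)
    (howned : ∀ o ∈ O, o.1 ∈ hand o.2) :
    HasSuccess hand O →
      ∃ lead L fin, PlaysFrom hand lead L fin ∧ Successful O L ∧
        L.length = O.card ∧ ∀ t ∈ L, ∃! o, o ∈ O ∧ Completes t o := by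
  classical
  rintro ⟨lead, L, fin, hL, hsucc⟩
  let P : (Fin p → Card) × Fin p → Prop := fun x => (x.1 x.2, x.2) ∈ O
  obtain ⟨L', fin', hL', hmap⟩ := hL.exists_filter P hand lead (fun _ => Finset.Subset.rfl) hsuit
  have hmem : ∀ t ∈ L', (t.play t.winner, t.winner) ∈ O := by
    intro t ht
    have : (t.play, t.winner) ∈ L'.map fun t => (t.play, t.winner) :=
      List.mem_map.2 ⟨t, ht, rfl⟩
    rw [hmap, List.mem_filter] at this
    simpa [P] using this.2
  have hex : ∀ o ∈ O, ∃ t ∈ L', (t.play t.winner, t.winner) = o := by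
    intro o ho
    obtain ⟨t, ht, hc⟩ := hsucc o ho
    have heq := hc.eq_winning_play hvalid.1 (hL.play_mem t ht) (howned o ho)
    have : (t.play, t.winner) ∈ L'.map fun t => (t.play, t.winner) := by
      rw [hmap, List.mem_filter]
      exact ⟨List.mem_map.2 ⟨t, ht, rfl⟩, by simpa [P] using heq ▸ ho⟩
    obtain ⟨t', ht', heq'⟩ := List.mem_map.1 this
    obtain ⟨h1, h2⟩ := Prod.mk.inj heq'
    exact ⟨t', ht', by rw [heq, h1, h2]⟩
  refine ⟨lead, L', fin', hL', fun o ho => ?_, ?_, fun t ht => ?_⟩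
  · obtain ⟨t, ht, rfl⟩ := hex o ho
    exact ⟨t, ht, ⟨_, rfl⟩, rfl⟩
  · have hO : (L'.map fun t => (t.play t.winner, t.winner)).toFinset = O := by
      ext o
      rw [List.mem_toFinset, List.mem_map]
      exact ⟨fun ⟨t, ht, h⟩ => h ▸ hmem t ht, hex o⟩
    rw [← hO, List.toFinset_card_of_nodup hL'.nodup_winning_plays, List.length_map]
  · exact ⟨_, ⟨hmem t ht, ⟨_, rfl⟩, rfl⟩, fun o ho =>
      ho.2.eq_winning_play hvalid.1 (hL'.play_mem t ht) (howned o ho.1)⟩
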